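/- (Proposition: reduction lemma.) Under the Setup with a complement Ỹ of Y' in Y, let H' := {h·x : h ∈ H, x ∈ X'} (a subgroup of V). For a function f : H' → ℂ define the induced class function Ind f : V → ℂ by (Ind f)(g) := |H'|⁻¹ · Σ_{v ∈ V, v·g·v⁻¹ ∈ H'} f(v·g·v⁻¹). Then the map η ↦ Ind η is a bijection from the set of characters η of finite-dimensional complex irreducible representations of H' satisfying (a) η(ỹ) = η(1) for all ỹ ∈ Ỹ (i.e. Ỹ ⊆ ker η) and (b) |Z|⁻¹ · Σ_{z ∈ Z} η(z)·conj(λ(z)) ≠ 0 (η lies over λ), onto the set of characters χ of finite-dimensional complex irreducible representations of V satisfying |Z|⁻¹ · Σ_{z ∈ Z} χ(z)·conj(λ(z)) ≠ 0 (χ lies over λ). In particular, for each such η the class function Ind η is itself the character of an irreducible representation of V. -/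

import Mathlib

open scoped Pointwise Classical

/-- `χ : G → ℂ` is the character of some finite-dimensional complex irreducible
representation of the group `G`. -/
def IsIrreducibleCharacter (G : Type) [Group G] (χ : G → ℂ) : Prop :=
  ∃ ρ : FDRep ℂ G, CategoryTheory.Simple ρ ∧ χ = ρ.character

structure RedData {V : Type} [Group V] (Z Yt H' : Subgroup V) (L : V → ℂ) : Prop where
  zc : ∀ z ∈ Z, ∀ v : V, z * v = v * z
  YH : Yt ≤ H'
  L_one : L 1 = 1
  L_mul : ∀ z ∈ Z, ∀ w ∈ Z, L (z * w) = L z * L w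
  comm : ∀ v : V, ∀ y ∈ Yt, v * y * v⁻¹ * y⁻¹ ∈ Z
  mem : ∀ v : V, v ∈ H' ↔ ∀ y ∈ Yt, L (v * y * v⁻¹ * y⁻¹) = 1
  triv : ∀ y ∈ Yt, (∀ v : V, L (v * y * v⁻¹ * y⁻¹) = 1) → y = 1

namespace RedData

variable {V : Type} [Group V] {Z Yt H' : Subgroup V} {L : V → ℂ}

lemma pair_mul_left (D : RedData Z Yt H' L) (v w y : V) (hy : y ∈ Yt) :
    L (v * w * y * (v * w)⁻¹ * y⁻¹) =
      L (v * y * v⁻¹ * y⁻¹) * L (w * y * w⁻¹ * y⁻¹) := by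
  rw [← D.L_mul _ (D.comm v y hy) _ (D.comm w y hy)]
  congr 1
  have h := D.zc _ (D.comm w y hy) (v * y * v⁻¹ * y⁻¹)
  have h2 := D.zc _ (D.comm w y hy) (y * v⁻¹ * y⁻¹)
  calc v * w * y * (v * w)⁻¹ * y⁻¹
      = v * ((w * y * w⁻¹ * y⁻¹) * (y * v⁻¹ * y⁻¹)) := by group
    _ = _ := by rw [h2]; group

lemma pair_mul_right (D : RedData Z Yt H' L) (v y y' : V) (hy : y ∈ Yt) (hy' : y' ∈ Yt) :
    L (v * (y * y') * v⁻¹ * (y * y')⁻¹) =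
      L (v * y * v⁻¹ * y⁻¹) * L (v * y' * v⁻¹ * y'⁻¹) := by
  rw [← D.L_mul _ (D.comm v y hy) _ (D.comm v y' hy')]
  congr 1
  have h2 := D.zc _ (D.comm v y' hy') y⁻¹
  calc v * (y * y') * v⁻¹ * (y * y')⁻¹
      = v * y * v⁻¹ * ((v * y' * v⁻¹ * y'⁻¹) * y⁻¹) := by group
    _ = _ := by rw [h2]; group

lemma L_ne (D : RedData Z Yt H' L) {z : V} (hz : z ∈ Z) : L z ≠ 0 := by
  intro h
  have := D.L_mul z hz z⁻¹ (Z.inv_mem hz)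
  rw [mul_inv_cancel, D.L_one, h, zero_mul] at this
  exact one_ne_zero this

lemma Z_le (D : RedData Z Yt H' L) : Z ≤ H' := by
  intro z hz
  rw [D.mem]
  intro y _
  rw [D.zc z hz y]
  simp [D.L_one]

variable [Fintype V]

lemma sum_left (D : RedData Z Yt H' L) (y : V) (hy : y ∈ Yt) :
    ∑ v : V, L (v * y * v⁻¹ * y⁻¹) = if y = 1 then (Nat.card V : ℂ) else 0 := by
  split_ifs with h
  · subst h; simp [D.L_one]
  · have : ∃ w : V, L (w * y * w⁻¹ * y⁻¹) ≠ 1 := by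
      by_contra! hc
      exact h (D.triv y hy hc)
    obtain ⟨w, hw⟩ := this
    have h1 : ∑ v : V, L (v * y * v⁻¹ * y⁻¹) =
        L (w * y * w⁻¹ * y⁻¹) * ∑ v : V, L (v * y * v⁻¹ * y⁻¹) := by
      rw [Finset.mul_sum, ← Equiv.sum_comp (Equiv.mulLeft w)]
      exact Finset.sum_congr rfl fun v _ => D.pair_mul_left w v y hy
    by_contra h0
    exact hw ((mul_eq_right₀ h0).1 h1.symm)

lemma exists_ne (D : RedData Z Yt H' L) {v : V} (hv : v ∉ H') :
    ∃ y ∈ Yt, L (v * y * v⁻¹ * y⁻¹) ≠ 1 := by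
  rw [D.mem] at hv; push Not at hv; exact hv

lemma sum_right (D : RedData Z Yt H' L) (v : V) :
    ∑ y : Yt, L (v * y * v⁻¹ * (y : V)⁻¹) = if v ∈ H' then (Nat.card Yt : ℂ) else 0 := by
  split_ifs with h
  · rw [Finset.sum_congr rfl fun (y : Yt) _ => (D.mem v).1 h y y.2]
    simp
  · obtain ⟨w, hw, hne⟩ := D.exists_ne h
    have h1 : ∑ y : Yt, L (v * y * v⁻¹ * (y : V)⁻¹) =
        L (v * w * v⁻¹ * w⁻¹) * ∑ y : Yt, L (v * y * v⁻¹ * (y : V)⁻¹) := by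
      rw [Finset.mul_sum, ← Equiv.sum_comp (Equiv.mulLeft (⟨w, hw⟩ : Yt))]
      exact Finset.sum_congr rfl fun y _ => D.pair_mul_right v w y hw y.2
    by_contra h0
    exact hne ((mul_eq_right₀ h0).1 h1.symm)

lemma card_eq (D : RedData Z Yt H' L) :
    (Nat.card V : ℂ) = Nat.card H' * Nat.card Yt := by
  have h1 : ∑ v : V, ∑ y : Yt, L (v * y * v⁻¹ * (y : V)⁻¹) = Nat.card H' * Nat.card Yt := by
    rw [Finset.sum_congr rfl fun v _ => D.sum_right v, ← Finset.sum_filter, Finset.sum_const,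
      nsmul_eq_mul]
    congr 2
    rw [Nat.card_eq_fintype_card, Fintype.card_subtype]
  rw [← h1, Finset.sum_comm, Finset.sum_congr rfl fun (y : Yt) _ => D.sum_left y y.2]
  rw [Finset.sum_eq_single (1 : Yt)]
  · simp
  · intro b _ hb; simp [hb]
  · simp

section Rep

variable {W : Type} [AddCommGroup W] [Module ℂ W]

/-- Averaging projector. -/
noncomputable def avg (Yt : Subgroup V) (ρ : Representation ℂ V W) : W →ₗ[ℂ] W :=
  (Nat.card Yt : ℂ)⁻¹ • ∑ y : Yt, ρ (y : V)

lemma card_ne (K : Subgroup V) : (Nat.card K : ℂ) ≠ 0 := by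
  exact_mod_cast Nat.card_pos.ne'

lemma mul_avg (ρ : Representation ℂ V W) (y : V) (hy : y ∈ Yt) :
    ρ y * avg Yt ρ = avg Yt ρ := by
  unfold avg
  rw [mul_smul_comm, Finset.mul_sum]
  congr 1
  rw [← Equiv.sum_comp (Equiv.mulLeft (⟨y, hy⟩ : Yt)) (fun y : Yt => ρ (y : V))]
  exact Finset.sum_congr rfl fun z _ => by simp

lemma avg_mul (ρ : Representation ℂ V W) (y : V) (hy : y ∈ Yt) :
    avg Yt ρ * ρ y = avg Yt ρ := by
  unfold avg
  rw [smul_mul_assoc, Finset.sum_mul]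
  congr 1
  rw [← Equiv.sum_comp (Equiv.mulRight (⟨y, hy⟩ : Yt)) (fun y : Yt => ρ (y : V))]
  exact Finset.sum_congr rfl fun z _ => by simp

lemma avg_of_fixed (ρ : Representation ℂ V W) (w : W) (hw : ∀ y ∈ Yt, ρ y w = w) :
    avg Yt ρ w = w := by
  unfold avg
  rw [LinearMap.smul_apply, LinearMap.sum_apply,
    Finset.sum_congr rfl fun (y : Yt) _ => hw y y.2]
  rw [Finset.sum_const, Finset.card_univ, ← Nat.card_eq_fintype_card, ← Nat.cast_smul_eq_nsmul ℂ,
    smul_smul, inv_mul_cancel₀ (card_ne Yt), one_smul]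

lemma conj_rho (D : RedData Z Yt H' L) (ρ : Representation ℂ V W)
    (hρ : ∀ z ∈ Z, ρ z = L z • 1) (v y : V) (hy : y ∈ Yt) :
    ρ v * ρ y = L (v * y * v⁻¹ * y⁻¹) • (ρ y * ρ v) := by
  have : v * y = (v * y * v⁻¹ * y⁻¹) * (y * v) := by group
  rw [← map_mul, this, map_mul, hρ _ (D.comm v y hy), map_mul, smul_mul_assoc, one_mul]
  congr 2
  group

lemma sum_conj (D : RedData Z Yt H' L) (ρ : Representation ℂ V W)
    (hρ : ∀ z ∈ Z, ρ z = L z • 1) :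
    ∑ v : V, ρ v * avg Yt ρ * ρ v⁻¹ = (Nat.card H' : ℂ) • 1 := by
  have h1 : ∀ v : V, ρ v * avg Yt ρ * ρ v⁻¹ =
      (Nat.card Yt : ℂ)⁻¹ • ∑ y : Yt, L (v * y * v⁻¹ * (y : V)⁻¹) • ρ (y : V) := by
    intro v
    unfold avg
    rw [mul_smul_comm, smul_mul_assoc, Finset.mul_sum, Finset.sum_mul]
    congr 1
    refine Finset.sum_congr rfl fun y _ => ?_
    rw [D.conj_rho ρ hρ v y y.2, smul_mul_assoc, mul_assoc (ρ (y : V)), ← map_mul ρ v, mul_inv_cancel, map_one,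
      mul_one]
  rw [Finset.sum_congr rfl fun v _ => h1 v, ← Finset.smul_sum, Finset.sum_comm]
  rw [Finset.sum_congr rfl fun (y : Yt) _ => (Finset.sum_smul (R := ℂ) (f := fun v : V =>
    L (v * y * v⁻¹ * (y : V)⁻¹)) (x := ρ (y : V))).symm]
  rw [Finset.sum_congr rfl fun (y : Yt) _ => by rw [D.sum_left y y.2]]
  rw [Finset.sum_eq_single (1 : Yt)]
  · simp only [OneMemClass.coe_one, if_true, map_one, smul_smul]
    rw [D.card_eq, mul_comm, mul_assoc, mul_inv_cancel₀ (card_ne Yt), mul_one]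
  · intro b _ hb; simp [hb]
  · simp

lemma trace_zero (D : RedData Z Yt H' L) (ρ : Representation ℂ V W)
    (hρ : ∀ z ∈ Z, ρ z = L z • 1) (k : V) (hk : k ∉ H') :
    LinearMap.trace ℂ W (ρ k * avg Yt ρ) = 0 := by
  obtain ⟨y, hy, hne⟩ := D.exists_ne hk
  have h1 : LinearMap.trace ℂ W (ρ k * avg Yt ρ) =
      L (k * y * k⁻¹ * y⁻¹) * LinearMap.trace ℂ W (ρ k * avg Yt ρ) := by
    conv_lhs => rw [← mul_avg ρ y hy, ← mul_assoc, D.conj_rho ρ hρ k y hy, smul_mul_assoc,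
      map_smul, mul_assoc (ρ y), LinearMap.trace_mul_comm, mul_assoc (ρ k), avg_mul ρ y hy]
    rfl
  by_contra h0
  exact hne ((mul_eq_right₀ h0).1 h1.symm)

/-- The character of `W` is induced from a model of the fixed space. -/
lemma char_ind (D : RedData Z Yt H' L) (ρ : Representation ℂ V W)
    (hρ : ∀ z ∈ Z, ρ z = L z • 1) {U : Type} [AddCommGroup U] [Module ℂ U]
    [FiniteDimensional ℂ U] [FiniteDimensional ℂ W]
    (σ : Representation ℂ H' U) (i : U →ₗ[ℂ] W) (p : W →ₗ[ℂ] U)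
    (hpi : p ∘ₗ i = LinearMap.id) (hip : i ∘ₗ p = avg Yt ρ)
    (hi : ∀ h : H', i ∘ₗ σ h = ρ (h : V) ∘ₗ i) (g : V) :
    LinearMap.trace ℂ W (ρ g) = (Nat.card H' : ℂ)⁻¹ *
      ∑ v : V, if hv : v * g * v⁻¹ ∈ H' then
        LinearMap.trace ℂ U (σ ⟨v * g * v⁻¹, hv⟩) else 0 := by
  have key : ∀ k : V, (if hv : k ∈ H' then LinearMap.trace ℂ U (σ ⟨k, hv⟩) else 0) =
      LinearMap.trace ℂ W (ρ k * avg Yt ρ) := by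
    intro k
    split_ifs with hk
    · rw [← hip]
      have : ρ k * (i ∘ₗ p) = (i ∘ₗ σ ⟨k, hk⟩) ∘ₗ p := by
        rw [hi]; rfl
      rw [this, LinearMap.trace_comp_comm', ← LinearMap.comp_assoc, hpi, LinearMap.id_comp]
    · exact (D.trace_zero ρ hρ k hk).symm
  rw [Finset.sum_congr rfl fun v _ => key _]
  have h2 : ∀ v : V, LinearMap.trace ℂ W (ρ (v * g * v⁻¹) * avg Yt ρ) =
      LinearMap.trace ℂ W (ρ g * (ρ v⁻¹ * avg Yt ρ * ρ v⁻¹⁻¹)) := by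
    intro v
    rw [inv_inv, map_mul ρ, map_mul ρ, mul_assoc, mul_assoc, LinearMap.trace_mul_comm]
    simp only [mul_assoc]
  have h3 := Equiv.sum_comp (Equiv.inv V) (fun v => ρ v * avg Yt ρ * ρ v⁻¹)
  simp only [Equiv.inv_apply] at h3
  rw [Finset.sum_congr rfl fun v _ => h2 v, ← map_sum, ← Finset.mul_sum, h3, D.sum_conj ρ hρ,
    mul_smul_comm, mul_one, map_smul, smul_eq_mul, ← mul_assoc, inv_mul_cancel₀ (card_ne H'),
    one_mul]

end Rep

/-- Isometry of induction. -/
lemma ind_inner (D : RedData Z Yt H' L) (F G : V → ℂ)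
    (hF : ∀ k, ∀ y ∈ Yt, F (k * y) = F k)
    (hG : ∀ k, ∀ y ∈ Yt, G (y * k) = G k)
    (hGZ : ∀ k, ∀ z ∈ Z, G (z * k) = L z * G k)
    (hGc : ∀ k, ∀ h ∈ H', G (h * k * h⁻¹) = G k) :
    ∑ g : V, ((Nat.card H' : ℂ)⁻¹ * ∑ v : V, F (v * g * v⁻¹)) *
      ((Nat.card H' : ℂ)⁻¹ * ∑ v : V, G (v * g⁻¹ * v⁻¹)) =
    (Nat.card V : ℂ) * (Nat.card H' : ℂ)⁻¹ * ∑ g : V, F g * G g⁻¹ := by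
  have hz : ∀ w : V, ∑ g : V, F g * G (w * g⁻¹ * w⁻¹) =
      if w ∈ H' then ∑ g : V, F g * G g⁻¹ else 0 := by
    intro w
    split_ifs with hw
    · exact Finset.sum_congr rfl fun g _ => by rw [hGc _ w hw]
    · obtain ⟨y, hy, hne⟩ := D.exists_ne hw
      have h1 : ∑ g : V, F g * G (w * g⁻¹ * w⁻¹) =
          L (w * y * w⁻¹ * y⁻¹) * ∑ g : V, F g * G (w * g⁻¹ * w⁻¹) := by
        rw [Finset.mul_sum]
        rw [← Equiv.sum_comp (Equiv.mulRight y⁻¹) (fun g => F g * G (w * g⁻¹ * w⁻¹))]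
        refine Finset.sum_congr rfl fun g _ => ?_
        simp only [Equiv.coe_mulRight]
        rw [hF _ _ (Yt.inv_mem hy)]
        have : w * (g * y⁻¹)⁻¹ * w⁻¹ = (w * y * w⁻¹ * y⁻¹) * (y * (w * g⁻¹ * w⁻¹)) := by group
        rw [this, hGZ _ _ (D.comm w y hy), hG _ _ hy]
        ring
      by_contra h0
      exact hne ((mul_eq_right₀ h0).1 h1.symm)
  have h3 : ∀ v : V, ∑ g : V, ∑ w : V, F (v * g * v⁻¹) * G (w * g⁻¹ * w⁻¹) =
      (Nat.card H' : ℂ) * ∑ g : V, F g * G g⁻¹ := by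
    intro v
    have : ∀ g : V, ∑ w : V, F (v * g * v⁻¹) * G (w * g⁻¹ * w⁻¹) =
        ∑ w : V, F (v * g * v⁻¹) * G (w * (v * g * v⁻¹)⁻¹ * w⁻¹) := by
      intro g
      rw [← Equiv.sum_comp (Equiv.mulRight v)
        (fun w => F (v * g * v⁻¹) * G (w * g⁻¹ * w⁻¹))]
      refine Finset.sum_congr rfl fun w _ => ?_
      simp only [Equiv.coe_mulRight]
      congr 2
      group
    rw [Finset.sum_congr rfl fun g _ => this g]
    have hc := Equiv.sum_comp (MulAut.conj v).toEquiv
      (fun g => ∑ w : V, F g * G (w * g⁻¹ * w⁻¹))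
    simp only [MulEquiv.toEquiv_eq_coe, EquivLike.coe_coe, MulAut.conj_apply] at hc
    rw [hc]
    rw [Finset.sum_comm, Finset.sum_congr rfl fun w _ => hz w, ← Finset.sum_filter,
      Finset.sum_const, nsmul_eq_mul]
    congr 2
    rw [Nat.card_eq_fintype_card, Fintype.card_subtype]
  have h4 : ∀ g : V, ((Nat.card H' : ℂ)⁻¹ * ∑ v : V, F (v * g * v⁻¹)) *
      ((Nat.card H' : ℂ)⁻¹ * ∑ v : V, G (v * g⁻¹ * v⁻¹)) =
      (Nat.card H' : ℂ)⁻¹ * (Nat.card H' : ℂ)⁻¹ *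
        ∑ v : V, ∑ w : V, F (v * g * v⁻¹) * G (w * g⁻¹ * w⁻¹) := by
    intro g
    rw [mul_mul_mul_comm, Finset.sum_mul_sum]
  rw [Finset.sum_congr rfl fun g _ => h4 g, ← Finset.mul_sum, Finset.sum_comm,
    Finset.sum_congr rfl fun v _ => h3 v, Finset.sum_const, Finset.card_univ,
    ← Nat.card_eq_fintype_card, nsmul_eq_mul]
  have := card_ne H'
  field_simp

end RedData

lemma sum_dite_subgroup {V : Type} [Group V] [Fintype V] (K : Subgroup V) (f : K → ℂ) :
    (∑ v : V, if h : v ∈ K then f ⟨v, h⟩ else 0) = ∑ k : K, f k := by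
  rw [Finset.sum_dite, Finset.sum_const_zero, add_zero]
  refine Finset.sum_bij' (fun x _ => ⟨x.1, (Finset.mem_filter.1 x.2).2⟩)
    (fun k _ => ⟨k.1, by simp⟩) ?_ ?_ ?_ ?_ ?_ <;> simp

lemma schur_scalar {G : Type} [Group G] (R : FDRep ℂ G) (hR : CategoryTheory.Simple R)
    (T : R →ₗ[ℂ] R) (hT : ∀ g, T ∘ₗ R.ρ g = R.ρ g ∘ₗ T) :
    ∃ c : ℂ, T = c • (1 : R →ₗ[ℂ] R) := by
  let f : R ⟶ R := ⟨CategoryTheory.InducedCategory.homMk (ModuleCat.ofHom T), fun g => by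
    ext1
    ext x
    exact LinearMap.congr_fun (hT g) x⟩
  obtain ⟨c, hc⟩ := CategoryTheory.endomorphism_simple_eq_smul_id ℂ f
  refine ⟨c, ?_⟩
  have := congrArg (fun f : R ⟶ R => f.hom.hom.hom) hc
  exact this.symm

lemma char_one_ne {G : Type} [Group G] [Fintype G] (R : FDRep ℂ G)
    (hR : CategoryTheory.Simple R) : (Module.finrank ℂ R : ℂ) ≠ 0 := by
  intro h
  have h0 : Module.finrank ℂ R = 0 := by exact_mod_cast h
  have h1 := (FDRep.simple_iff_char_is_norm_one R).1 hR
  have : Subsingleton R := Module.finrank_zero_iff.1 h0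
  have h2 : ∀ g, R.character g = 0 := by
    intro g
    unfold FDRep.character
    rw [Subsingleton.elim (R.ρ g) 0, map_zero]
  simp only [h2, mul_zero, Finset.sum_const_zero] at h1
  have : (Nat.card G : ℂ) ≠ 0 := by exact_mod_cast Nat.card_pos.ne'
  exact this h1.symm

lemma lam_conj {Z : Type} [Group Z] [Finite Z] (lam : Z →* ℂˣ) (z : Z) :
    (starRingEnd ℂ) (lam z : ℂ) = ((lam z⁻¹ : ℂˣ) : ℂ) := by
  have h1 : (lam z : ℂ) ^ Nat.card Z = 1 := by
    rw [← Units.val_pow_eq_pow_val, ← map_pow, pow_card_eq_one', map_one, Units.val_one]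
  have h2 : ‖(lam z : ℂ)‖ = 1 := Complex.norm_eq_one_of_pow_eq_one h1 Nat.card_pos.ne'
  rw [map_inv, Units.val_inv_eq_inv_val, ← Complex.inv_eq_conj h2]

lemma central_acts {G Z : Type} [Group G] [Group Z] [Fintype Z] (R : FDRep ℂ G)
    (hR : CategoryTheory.Simple R) (j : Z →* G) (hj : ∀ z g, j z * g = g * j z) (lam : Z →* ℂˣ)
    (h : ∑ z : Z, R.character (j z) * (starRingEnd ℂ) (lam z : ℂ) ≠ 0) (w : Z) :
    R.ρ (j w) = (lam w : ℂ) • (1 : R →ₗ[ℂ] R) := by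
  let P : R →ₗ[ℂ] R := ∑ z : Z, ((lam z⁻¹ : ℂˣ) : ℂ) • R.ρ (j z)
  have hP : ∀ g, P * R.ρ g = R.ρ g * P := by
    intro g
    simp only [P, Finset.sum_mul, Finset.mul_sum, smul_mul_assoc, mul_smul_comm]
    refine Finset.sum_congr rfl fun z _ => ?_
    rw [← map_mul, hj, map_mul]
  obtain ⟨c, hc⟩ := schur_scalar R hR P hP
  have htr : LinearMap.trace ℂ R P ≠ 0 := by
    convert h
    simp only [P, map_sum, map_smul, smul_eq_mul]
    refine Finset.sum_congr rfl fun z _ => ?_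
    rw [lam_conj, mul_comm]; rfl
  have hc0 : c ≠ 0 := by
    rintro rfl
    rw [hc, zero_smul, map_zero] at htr
    exact htr rfl
  have hw : R.ρ (j w) * P = (lam w : ℂ) • P := by
    simp only [P, Finset.mul_sum, Finset.smul_sum]
    rw [← Equiv.sum_comp (Equiv.mulLeft w)
      (fun z => (lam w : ℂ) • ((lam z⁻¹ : ℂˣ) : ℂ) • R.ρ (j z))]
    refine Finset.sum_congr rfl fun z _ => ?_
    simp only [Equiv.coe_mulLeft, mul_smul_comm, map_mul, smul_smul, mul_inv_rev, Units.val_mul]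
    congr 1
    rw [map_inv lam w, mul_comm ((lam z⁻¹ : ℂˣ) : ℂ), ← mul_assoc, Units.mul_inv, one_mul]
  rw [hc, mul_smul_comm, mul_one, smul_comm] at hw
  exact smul_right_injective _ hc0 hw

namespace RedData

variable {V : Type} [Group V] {Z Yt H' : Subgroup V} {L : V → ℂ} [Fintype V]

lemma rep_inner (D : RedData Z Yt H' L) {U₁ U₂ : Type} [AddCommGroup U₁] [Module ℂ U₁]
    [AddCommGroup U₂] [Module ℂ U₂]
    (σ : Representation ℂ H' U₁) (τ : Representation ℂ H' U₂)
    (hσY : ∀ y (hy : y ∈ Yt), σ ⟨y, D.YH hy⟩ = 1)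
    (hτY : ∀ y (hy : y ∈ Yt), τ ⟨y, D.YH hy⟩ = 1)
    (hτZ : ∀ z (hz : z ∈ Z), τ ⟨z, D.Z_le hz⟩ = L z • 1) :
    ∑ g : V, ((Nat.card H' : ℂ)⁻¹ * ∑ v : V, if hv : v * g * v⁻¹ ∈ H' then
        LinearMap.trace ℂ U₁ (σ ⟨v * g * v⁻¹, hv⟩) else 0) *
      ((Nat.card H' : ℂ)⁻¹ * ∑ v : V, if hv : v * g⁻¹ * v⁻¹ ∈ H' then
        LinearMap.trace ℂ U₂ (τ ⟨v * g⁻¹ * v⁻¹, hv⟩) else 0) =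
    (Nat.card V : ℂ) * (Nat.card H' : ℂ)⁻¹ * ∑ h : H',
      LinearMap.trace ℂ U₁ (σ h) * LinearMap.trace ℂ U₂ (τ h⁻¹) := by
  have key := D.ind_inner
    (fun v => if hv : v ∈ H' then LinearMap.trace ℂ U₁ (σ ⟨v, hv⟩) else 0)
    (fun v => if hv : v ∈ H' then LinearMap.trace ℂ U₂ (τ ⟨v, hv⟩) else 0)
    ?_ ?_ ?_ ?_
  · rw [key, ← sum_dite_subgroup]
    congr 1
    refine Finset.sum_congr rfl fun g _ => ?_
    by_cases hg : g ∈ H'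
    · have hg' := H'.inv_mem hg
      simp only [hg, hg', dif_pos]
      rfl
    · simp [hg]
  · intro k y hy
    by_cases hk : k ∈ H'
    · have hky := H'.mul_mem hk (D.YH hy)
      simp only [hk, hky, dif_pos]
      have : (⟨k * y, hky⟩ : H') = ⟨k, hk⟩ * ⟨y, D.YH hy⟩ := rfl
      rw [this, map_mul, hσY y hy, mul_one]
    · have hky : k * y ∉ H' := fun h => hk ((H'.mul_mem_cancel_right (D.YH hy)).1 h)
      simp only [hk, hky, dif_neg, not_false_eq_true]
  · intro k y hy
    by_cases hk : k ∈ H'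
    · have hky := H'.mul_mem (D.YH hy) hk
      simp only [hk, hky, dif_pos]
      have : (⟨y * k, hky⟩ : H') = ⟨y, D.YH hy⟩ * ⟨k, hk⟩ := rfl
      rw [this, map_mul, hτY y hy, one_mul]
    · have hky : y * k ∉ H' := fun h => hk ((H'.mul_mem_cancel_left (D.YH hy)).1 h)
      simp only [hk, hky, dif_neg, not_false_eq_true]
  · intro k y hy
    by_cases hk : k ∈ H'
    · have hky := H'.mul_mem (D.Z_le hy) hk
      simp only [hk, hky, dif_pos]
      have : (⟨y * k, hky⟩ : H') = ⟨y, D.Z_le hy⟩ * ⟨k, hk⟩ := rfl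
      rw [this, map_mul, hτZ y hy, smul_mul_assoc, one_mul, map_smul, smul_eq_mul]
    · have hky : y * k ∉ H' := fun h => hk ((H'.mul_mem_cancel_left (D.Z_le hy)).1 h)
      simp only [hk, hky, dif_neg, not_false_eq_true, mul_zero]
  · intro k h hh
    by_cases hk : k ∈ H'
    · have hky := H'.mul_mem (H'.mul_mem hh hk) (H'.inv_mem hh)
      simp only [hk, hky, dif_pos]
      have : (⟨h * k * h⁻¹, hky⟩ : H') = ⟨h, hh⟩ * ⟨k, hk⟩ * (⟨h, hh⟩)⁻¹ := rfl
      rw [this, map_mul τ, LinearMap.trace_mul_comm, ← map_mul τ, inv_mul_cancel_left]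
    · have hky : h * k * h⁻¹ ∉ H' := fun h' => hk (by
        rw [H'.mul_mem_cancel_right (H'.inv_mem hh), H'.mul_mem_cancel_left hh] at h'
        exact h')
      simp only [hk, hky, dif_neg, not_false_eq_true]

lemma coind_Z (D : RedData Z Yt H' L) {U : Type} [AddCommGroup U] [Module ℂ U]
    (σ : Representation ℂ H' U)
    (hZ : ∀ z (hz : z ∈ Z), σ ⟨z, D.Z_le hz⟩ = L z • 1) (z : V) (hz : z ∈ Z) :
    Representation.coind H'.subtype σ z = L z • 1 := by
  ext f v
  have := f.2 ⟨z, D.Z_le hz⟩ v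
  rw [hZ z hz] at this
  simp only [Subgroup.subtype_apply, D.zc z hz] at this
  have h2 : (Representation.coind H'.subtype σ z f).1 v = f.1 (v * z) := rfl
  rw [h2]
  exact this

lemma coind_char (D : RedData Z Yt H' L) {U : Type} [AddCommGroup U] [Module ℂ U]
    [FiniteDimensional ℂ U] (σ : Representation ℂ H' U)
    (hY : ∀ y (hy : y ∈ Yt), σ ⟨y, D.YH hy⟩ = 1)
    (hZ : ∀ z (hz : z ∈ Z), σ ⟨z, D.Z_le hz⟩ = L z • 1) (g : V) :
    LinearMap.trace ℂ _ (Representation.coind H'.subtype σ g) = (Nat.card H' : ℂ)⁻¹ *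
      ∑ v : V, if hv : v * g * v⁻¹ ∈ H' then
        LinearMap.trace ℂ U (σ ⟨v * g * v⁻¹, hv⟩) else 0 := by
  let p : Representation.coindV H'.subtype σ →ₗ[ℂ] U :=
    { toFun := fun f => f.1 1
      map_add' := fun _ _ => rfl
      map_smul' := fun _ _ => rfl }
  let i : U →ₗ[ℂ] Representation.coindV H'.subtype σ :=
    { toFun := fun u => ⟨fun v => if hv : v ∈ H' then σ ⟨v, hv⟩ u else 0, by
        intro h v
        by_cases hv : v ∈ H'
        · have h2 := H'.mul_mem h.2 hv
          beta_reduce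
          rw [Subgroup.subtype_apply, dif_pos h2, dif_pos hv, ← Module.End.mul_apply, ← map_mul]
          rfl
        · have h2 : (h : V) * v ∉ H' := fun h' => hv ((H'.mul_mem_cancel_left h.2).1 h')
          beta_reduce
          rw [Subgroup.subtype_apply, dif_neg h2, dif_neg hv, map_zero]⟩
      map_add' := fun a b => by
        ext v
        by_cases hv : v ∈ H' <;> simp [hv]
      map_smul' := fun a b => by
        ext v
        by_cases hv : v ∈ H' <;> simp [hv] }
  refine D.char_ind _ (D.coind_Z σ hZ) σ i p ?_ ?_ ?_ g
  · ext u
    have : (⟨1, H'.one_mem⟩ : H') = 1 := rfl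
    simp [p, i, H'.one_mem, this]
  · ext f v
    have hL : ((i ∘ₗ p) f).1 v = if hv : v ∈ H' then σ ⟨v, hv⟩ (f.1 1) else 0 := rfl
    have hR : (avg Yt (Representation.coind H'.subtype σ) f).1 v =
        (Nat.card Yt : ℂ)⁻¹ • ∑ y : Yt, f.1 (v * y) := by
      rw [avg, LinearMap.smul_apply, LinearMap.sum_apply, Submodule.coe_smul, Submodule.coe_sum,
        Pi.smul_apply, Finset.sum_apply]
      rfl
    have hf : ∀ y : Yt, f.1 (v * y) = L (v * y * v⁻¹ * (y : V)⁻¹) • f.1 v := by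
      intro y
      have h1 : v * (y : V) = (v * y * v⁻¹ * (y : V)⁻¹) * (y * v) := by group
      have h2 := f.2 ⟨_, D.Z_le (D.comm v y y.2)⟩ (y * v)
      have h3 := f.2 ⟨_, D.YH y.2⟩ v
      rw [hZ _ (D.comm v y y.2)] at h2
      rw [hY y y.2] at h3
      simp only [Subgroup.subtype_apply] at h2 h3
      rw [← h1, h3] at h2
      exact h2
    rw [hL, hR, Finset.sum_congr rfl fun y _ => hf y, ← Finset.sum_smul, D.sum_right v, smul_smul]
    split_ifs with hv
    · have h4 := f.2 ⟨v, hv⟩ 1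
      rw [inv_mul_cancel₀ (card_ne Yt), one_smul, ← h4]
      simp
    · simp
  · intro h
    ext u v
    have hL : ((i ∘ₗ σ h) u).1 v = if hv : v ∈ H' then σ ⟨v, hv⟩ (σ h u) else 0 := rfl
    have hR : ((Representation.coind H'.subtype σ h ∘ₗ i) u).1 v =
      if hv : v * h ∈ H' then σ ⟨v * h, hv⟩ u else 0 := rfl
    rw [hL, hR]
    by_cases hv : v ∈ H'
    · have h2 := H'.mul_mem hv h.2
      simp only [hv, h2, dif_pos]
      rw [← Module.End.mul_apply, ← map_mul]
      rfl
    · have h2 : v * (h : V) ∉ H' := fun h' => hv ((H'.mul_mem_cancel_right h.2).1 h')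
      simp only [hv, h2, dif_neg, not_false_eq_true]

/-- The fixed space of `Yt` as a representation of `H'`. -/
lemma exists_fixed (D : RedData Z Yt H' L) {W : Type} [AddCommGroup W] [Module ℂ W]
    [FiniteDimensional ℂ W] (ρ : Representation ℂ V W)
    (hρ : ∀ z ∈ Z, ρ z = L z • 1) :
    ∃ (U : Submodule ℂ W) (σ : Representation ℂ H' U),
      (∀ y (hy : y ∈ Yt), σ ⟨y, D.YH hy⟩ = 1) ∧
      (∀ z (hz : z ∈ Z), σ ⟨z, D.Z_le hz⟩ = L z • 1) ∧
      ∀ g : V, LinearMap.trace ℂ W (ρ g) = (Nat.card H' : ℂ)⁻¹ *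
        ∑ v : V, if hv : v * g * v⁻¹ ∈ H' then
          LinearMap.trace ℂ U (σ ⟨v * g * v⁻¹, hv⟩) else 0 := by
  let U : Submodule ℂ W :=
    { carrier := {w | ∀ y ∈ Yt, ρ y w = w}
      add_mem' := fun {a b} ha hb y hy => by rw [map_add, ha y hy, hb y hy]
      zero_mem' := fun y _ => map_zero _
      smul_mem' := fun c a ha y hy => by rw [map_smul, ha y hy] }
  have hst : ∀ (h : H') (w : W), w ∈ U → ρ (h : V) w ∈ U := by
    intro h w hw y hy
    have h1 := LinearMap.congr_fun (D.conj_rho ρ hρ h y hy) w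
    rw [(D.mem _).1 h.2 y hy, one_smul, Module.End.mul_apply, Module.End.mul_apply, hw y hy] at h1
    exact h1.symm
  let σ : Representation ℂ H' U :=
    { toFun := fun h => (ρ (h : V)).restrict (hst h)
      map_one' := by ext w; simp
      map_mul' := fun a b => by ext w; simp }
  refine ⟨U, σ, ?_, ?_, ?_⟩
  · intro y hy
    ext w
    exact w.2 y hy
  · intro z hz
    ext w
    exact LinearMap.congr_fun (hρ z hz) w.1
  · have hU : ∀ w, avg Yt ρ w ∈ U := fun w y hy => by
      rw [← Module.End.mul_apply, mul_avg ρ y hy]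
    refine D.char_ind ρ hρ σ U.subtype ((avg Yt ρ).codRestrict U hU) ?_ ?_ ?_
    · ext w
      exact avg_of_fixed ρ w.1 w.2
    · rfl
    · intro h; rfl

end RedData

set_option maxHeartbeats 2000000

/-- **reduction lemma.** Under the Setup with a complement `Ỹ` of `Y'` in
`Y`, and with `H' = H·X'`, the induction map `η ↦ Ind η`, where
`(Ind f)(g) = |H'|⁻¹ · Σ_{v ∈ V, v·g·v⁻¹ ∈ H'} f(v·g·v⁻¹)`, is a bijection from the set
of irreducible characters `η` of `H'` with `Ỹ ⊆ ker η` lying over `λ` onto the set of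
irreducible characters of `V` lying over `λ`.  In particular each such `Ind η` is itself
an irreducible character of `V`. -/
theorem reduction_lemma
    {V : Type} [Group V] [Fintype V]
    (H Y Z : Subgroup V) (X : Set V)
    (hXrep : ∀ v : V, ∃! p : ↥H × ↥X, (p.1 : V) * (p.2 : V) = v)
    (hZcent : Z ≤ Subgroup.center V)
    (hYH : Y ≤ H)
    (hYcent : ∀ y ∈ Y, ∀ h ∈ H, y * h = h * y)
    (hZY : Z ⊓ Y = ⊥)
    (lam : Z →* ℂˣ)
    (hXYZ : ∀ x ∈ X, ∀ y ∈ Y, x⁻¹ * y⁻¹ * x * y ∈ Z)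
    -- `H'` is the subgroup `H·X'` of `V`
    (H' : Subgroup V)
    (hH' : (H' : Set V) = {v : V | ∃ h ∈ H, ∃ x ∈ X,
      (∀ (y : V) (hy : y ∈ Y) (hc : x⁻¹ * y⁻¹ * x * y ∈ Z),
        lam ⟨x⁻¹ * y⁻¹ * x * y, hc⟩ = 1) ∧ v = h * x})
    -- `Ỹ` is a complement of `Y' = {y ∈ Y : λ([x,y]) = 1 ∀ x ∈ X}` in `Y`
    (Yt : Subgroup V) (hYtY : Yt ≤ Y)
    (hcompl₁ : ∀ y : V, y ∈ Yt →
      (y ∈ Y ∧ ∀ x ∈ X, ∀ (hc : x⁻¹ * y⁻¹ * x * y ∈ Z),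
        lam ⟨x⁻¹ * y⁻¹ * x * y, hc⟩ = 1) → y = 1)
    (hcompl₂ : ∀ y ∈ Y, ∃ y' : V,
      (y' ∈ Y ∧ ∀ x ∈ X, ∀ (hc : x⁻¹ * y'⁻¹ * x * y' ∈ Z),
        lam ⟨x⁻¹ * y'⁻¹ * x * y', hc⟩ = 1) ∧ ∃ yt ∈ Yt, y = y' * yt) :
    Set.BijOn
      -- the induction map `η ↦ Ind η`
      (fun (η : ↥H' → ℂ) (g : V) =>
        (Nat.card ↥H' : ℂ)⁻¹ *
          ∑ v : V, if hv : v * g * v⁻¹ ∈ H' then η ⟨v * g * v⁻¹, hv⟩ else 0)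
      -- the set of irreducible characters of `H'` with `Ỹ ⊆ ker η` lying over `λ`
      {η : ↥H' → ℂ | IsIrreducibleCharacter ↥H' η ∧
        (∀ (yt : V) (hyt : yt ∈ Yt) (hm : yt ∈ H'), η ⟨yt, hm⟩ = η 1) ∧
        (Nat.card ↥Z : ℂ)⁻¹ *
            (∑ z : V, if hz : z ∈ Z then
              (if hm : z ∈ H' then η ⟨z, hm⟩ else 0) *
                (starRingEnd ℂ) ((lam ⟨z, hz⟩ : ℂˣ) : ℂ) else 0) ≠ 0}
      -- the set of irreducible characters of `V` lying over `λ`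
      {χ : V → ℂ | IsIrreducibleCharacter V χ ∧
        (Nat.card ↥Z : ℂ)⁻¹ *
            (∑ z : V, if hz : z ∈ Z then
              χ z * (starRingEnd ℂ) ((lam ⟨z, hz⟩ : ℂˣ) : ℂ) else 0) ≠ 0} := by
  have hZc : ∀ z ∈ Z, ∀ v : V, z * v = v * z := fun z hz v =>
    ((Subgroup.mem_center_iff.1 (hZcent hz)) v).symm
  obtain ⟨L, hL⟩ : ∃ L : V → ℂ, ∀ z (hz : z ∈ Z), L z = ((lam ⟨z, hz⟩ : ℂˣ) : ℂ) :=
    ⟨fun z => if hz : z ∈ Z then ((lam ⟨z, hz⟩ : ℂˣ) : ℂ) else 0, fun z hz => by simp [hz]⟩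
  have hL1 : L 1 = 1 := by
    rw [hL 1 Z.one_mem]
    have : (⟨1, Z.one_mem⟩ : Z) = 1 := rfl
    rw [this, map_one, Units.val_one]
  have hLm : ∀ z ∈ Z, ∀ w ∈ Z, L (z * w) = L z * L w := by
    intro z hz w hw
    rw [hL _ (Z.mul_mem hz hw), hL z hz, hL w hw, ← Units.val_mul, ← map_mul]
    rfl
  have hLi : ∀ z ∈ Z, (L z⁻¹ = 1 ↔ L z = 1) := by
    intro z hz
    have h := hLm z hz z⁻¹ (Z.inv_mem hz)
    rw [mul_inv_cancel, hL1] at h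
    constructor
    · intro h'; rw [h', mul_one] at h; exact h.symm
    · intro h'; rw [h', one_mul] at h; exact h.symm
  have hLe : ∀ z (hz : z ∈ Z), (lam ⟨z, hz⟩ = 1 ↔ L z = 1) := by
    intro z hz
    rw [hL z hz, Units.val_eq_one]
  have hred : ∀ h ∈ H, ∀ x : V, ∀ y ∈ Y,
      (h * x)⁻¹ * y⁻¹ * (h * x) * y = x⁻¹ * y⁻¹ * x * y := by
    intro h hh x y hy
    have h1 := hYcent y⁻¹ (Y.inv_mem hy) h hh
    calc (h * x)⁻¹ * y⁻¹ * (h * x) * y = x⁻¹ * h⁻¹ * (y⁻¹ * h) * x * y := by group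
      _ = _ := by rw [h1]; group
  have hdec : ∀ v : V, ∃ h ∈ H, ∃ x ∈ X, v = h * x := by
    intro v
    obtain ⟨p, hp, -⟩ := hXrep v
    exact ⟨p.1, p.1.2, p.2, p.2.2, hp.symm⟩
  have hcomm1 : ∀ v : V, ∀ y ∈ Y, v⁻¹ * y⁻¹ * v * y ∈ Z := by
    intro v y hy
    obtain ⟨h, hh, x, hx, rfl⟩ := hdec v
    rw [hred h hh x y hy]
    exact hXYZ x hx y hy
  have hcomm : ∀ v : V, ∀ y ∈ Y, v * y * v⁻¹ * y⁻¹ ∈ Z := by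
    intro v y hy
    have := hcomm1 v⁻¹ y⁻¹ (Y.inv_mem hy)
    simpa using this
  have hflip : ∀ v : V, ∀ y ∈ Y,
      v⁻¹ * y⁻¹ * v * y = (v⁻¹ * y * v⁻¹⁻¹ * y⁻¹)⁻¹ := by
    intro v y hy
    have h1 := hZc _ (Z.inv_mem (hcomm v⁻¹ y hy)) y
    calc v⁻¹ * y⁻¹ * v * y = y⁻¹ * ((v⁻¹ * y * v⁻¹⁻¹ * y⁻¹)⁻¹ * y) := by group
      _ = _ := by rw [h1]; group
  have hflipL : ∀ v : V, ∀ y ∈ Y,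
      (L (v⁻¹ * y⁻¹ * v * y) = 1 ↔ L (v⁻¹ * y * v⁻¹⁻¹ * y⁻¹) = 1) := by
    intro v y hy
    rw [hflip v y hy, hLi _ (hcomm v⁻¹ y hy)]
  have hmem1 : ∀ v : V, v ∈ H' ↔ ∀ y ∈ Y, L (v⁻¹ * y⁻¹ * v * y) = 1 := by
    intro v
    rw [← SetLike.mem_coe, hH']
    constructor
    · rintro ⟨h, hh, x, hx, hc, rfl⟩ y hy
      rw [hred h hh x y hy, ← hLe _ (hXYZ x hx y hy)]
      exact hc y hy _
    · intro hv
      obtain ⟨h, hh, x, hx, rfl⟩ := hdec v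
      refine ⟨h, hh, x, hx, fun y hy hc => ?_, rfl⟩
      rw [hLe, ← hred h hh x y hy]
      exact hv y hy
  have hmem2 : ∀ v : V, v ∈ H' ↔ ∀ y ∈ Y, L (v * y * v⁻¹ * y⁻¹) = 1 := by
    intro v
    rw [← H'.inv_mem_iff, hmem1]
    refine forall₂_congr fun y hy => ?_
    rw [hflipL _ _ hy, inv_inv]
  have hY' : ∀ y ∈ Y, (∀ x ∈ X, ∀ (hc : x⁻¹ * y⁻¹ * x * y ∈ Z),
        lam ⟨x⁻¹ * y⁻¹ * x * y, hc⟩ = 1) ↔ ∀ v : V, L (v * y * v⁻¹ * y⁻¹) = 1 := by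
    intro y hy
    constructor
    · intro hx v
      have := hflipL v⁻¹ y hy
      rw [inv_inv] at this
      rw [← this]
      obtain ⟨h, hh, x, hx', he⟩ := hdec v⁻¹
      have hv : v = (h * x)⁻¹ := by rw [← he, inv_inv]
      rw [he, hv, hred h hh x y hy, ← hLe _ (hXYZ x hx' y hy)]
      exact hx x hx' _
    · intro hv x hx hc
      rw [hLe, hflipL x y hy]
      exact hv x⁻¹
  have D : RedData Z Yt H' L :=
    { zc := hZc
      YH := by
        intro y hy
        rw [hmem2]
        intro y' hy'
        rw [← hYcent y' hy' y (hYH (hYtY hy))]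
        simp [hL1]
      L_one := hL1
      L_mul := hLm
      comm := fun v y hy => hcomm v y (hYtY hy)
      mem := by
        intro v
        rw [hmem2]
        refine ⟨fun h y hy => h y (hYtY hy), fun h y hy => ?_⟩
        obtain ⟨y', ⟨hy'Y, hy'⟩, yt, hyt, rfl⟩ := hcompl₂ y hy
        have h1 := (hY' y' hy'Y).1 hy' v
        have h2 := hZc _ (hcomm v yt (hYtY hyt)) y'⁻¹
        have h3 : v * (y' * yt) * v⁻¹ * (y' * yt)⁻¹ =
            (v * y' * v⁻¹ * y'⁻¹) * (v * yt * v⁻¹ * yt⁻¹) := by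
          calc v * (y' * yt) * v⁻¹ * (y' * yt)⁻¹
              = v * y' * v⁻¹ * ((v * yt * v⁻¹ * yt⁻¹) * y'⁻¹) := by group
            _ = _ := by rw [h2]; group
        rw [h3, hLm _ (hcomm v y' hy'Y) _ (hcomm v yt (hYtY hyt)), h1, h yt hyt, one_mul]
      triv := fun y hy h => hcompl₁ y hy ⟨hYtY hy, (hY' y (hYtY hy)).2 h⟩ }
  clear hmem1 hmem2 hY' hflipL hflip hcomm hcomm1 hdec hred hLe hLi hcompl₁ hcompl₂ hH' hXYZ hXrep
  have hcV : (Nat.card V : ℂ) ≠ 0 := by exact_mod_cast Nat.card_pos.ne'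
  have hcH := RedData.card_ne H'
  have hcZ := RedData.card_ne Z
  -- sums over `Z`
  have hsumV : ∀ χ : V → ℂ, (∑ z : V, if hz : z ∈ Z then
      χ z * (starRingEnd ℂ) ((lam ⟨z, hz⟩ : ℂˣ) : ℂ) else 0) =
      ∑ z : Z, χ z * (starRingEnd ℂ) ((lam z : ℂˣ) : ℂ) := fun χ =>
    sum_dite_subgroup Z (fun z => χ z * (starRingEnd ℂ) ((lam z : ℂˣ) : ℂ))
  have hsumH : ∀ η : H' → ℂ, (∑ z : V, if hz : z ∈ Z then
      (if hm : z ∈ H' then η ⟨z, hm⟩ else 0) * (starRingEnd ℂ) ((lam ⟨z, hz⟩ : ℂˣ) : ℂ) else 0) =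
      ∑ z : Z, η (Subgroup.inclusion D.Z_le z) * (starRingEnd ℂ) ((lam z : ℂˣ) : ℂ) := by
    intro η
    rw [← sum_dite_subgroup]
    refine Finset.sum_congr rfl fun z _ => ?_
    by_cases hz : z ∈ Z
    · have hz' := D.Z_le hz
      simp only [hz, hz', dif_pos]
      rfl
    · simp [hz]
  have hone : ∀ z : Z, ((lam z : ℂˣ) : ℂ) * (starRingEnd ℂ) ((lam z : ℂˣ) : ℂ) = 1 := by
    intro z
    rw [lam_conj, map_inv, Units.mul_inv]
  -- actions of `Z` and `Yt` on the relevant representations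
  have hactH : ∀ S : FDRep ℂ H', CategoryTheory.Simple S →
      (∀ (yt : V) (hyt : yt ∈ Yt) (hm : yt ∈ H'), S.character ⟨yt, hm⟩ = S.character 1) →
      (∑ z : Z, S.character (Subgroup.inclusion D.Z_le z) *
        (starRingEnd ℂ) ((lam z : ℂˣ) : ℂ)) ≠ 0 →
      (∀ y (hy : y ∈ Yt), S.ρ ⟨y, D.YH hy⟩ = 1) ∧
      (∀ z (hz : z ∈ Z), S.ρ ⟨z, D.Z_le hz⟩ = L z • 1) := by
    intro S hS hker hover
    have hZ : ∀ z (hz : z ∈ Z), S.ρ ⟨z, D.Z_le hz⟩ = L z • 1 := by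
      intro z hz
      rw [hL z hz]
      exact central_acts S hS (Subgroup.inclusion D.Z_le)
        (fun z g => Subtype.ext (hZc z z.2 g)) lam hover ⟨z, hz⟩
    refine ⟨fun y hy => ?_, hZ⟩
    obtain ⟨c, hc⟩ := schur_scalar S hS (S.ρ ⟨y, D.YH hy⟩) (by
      intro g
      have h1 : g * ⟨y, D.YH hy⟩ =
          (⟨_, D.Z_le (D.comm g y hy)⟩ : H') * (⟨y, D.YH hy⟩ * g) := by
        apply Subtype.ext
        simp
      have h2 := congrArg S.ρ h1
      rw [map_mul, map_mul, map_mul, hZ _ (D.comm g y hy), (D.mem _).1 g.2 y hy, one_smul,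
        one_mul] at h2
      exact h2.symm)
    have h1 := hker y hy (D.YH hy)
    rw [FDRep.char_one, FDRep.character, hc, map_smul, LinearMap.trace_one, smul_eq_mul] at h1
    rw [hc, (mul_eq_right₀ (char_one_ne S hS)).1 h1, one_smul]
  refine ⟨?_, ?_, ?_⟩
  · rintro η ⟨⟨S, hS, rfl⟩, hker, hover⟩
    rw [hsumH] at hover
    obtain ⟨hY, hZ⟩ := hactH S hS hker (right_ne_zero_of_mul hover)
    have hchar : (FDRep.of (Representation.coind H'.subtype S.ρ)).character = fun g : V =>
        (Nat.card ↥H' : ℂ)⁻¹ *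
          ∑ v : V, if hv : v * g * v⁻¹ ∈ H' then S.character ⟨v * g * v⁻¹, hv⟩ else 0 := by
      funext g
      exact D.coind_char S.ρ hY hZ g
    have hsimp : CategoryTheory.Simple (FDRep.of (Representation.coind H'.subtype S.ρ)) := by
      rw [FDRep.simple_iff_char_is_norm_one, hchar]
      refine (D.rep_inner S.ρ S.ρ hY hY hZ).trans ?_
      have := (FDRep.simple_iff_char_is_norm_one S).1 hS
      unfold FDRep.character at this
      rw [this, mul_assoc, inv_mul_cancel₀ hcH, mul_one]
    refine ⟨⟨_, hsimp, hchar.symm⟩, ?_⟩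
    beta_reduce
    rw [hsumV]
    have h1 : ∀ z : Z, (FDRep.of (Representation.coind H'.subtype S.ρ)).character (z : V) *
        (starRingEnd ℂ) ((lam z : ℂˣ) : ℂ) =
        Module.finrank ℂ (FDRep.of (Representation.coind H'.subtype S.ρ)) := by
      intro z
      have h2 : (FDRep.of (Representation.coind H'.subtype S.ρ)).ρ (z : V) = L z • 1 :=
        D.coind_Z S.ρ hZ z z.2
      rw [FDRep.character, h2, map_smul, LinearMap.trace_one, smul_eq_mul, hL z z.2, mul_right_comm,
        hone, one_mul]
    have h3 := fun z : Z => h1 z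
    simp only [hchar] at h3
    rw [Finset.sum_congr rfl fun z _ => h3 z, Finset.sum_const, Finset.card_univ,
      ← Nat.card_eq_fintype_card, nsmul_eq_mul, ← mul_assoc, inv_mul_cancel₀ hcZ, one_mul]
    exact char_one_ne _ hsimp
  · rintro η₁ ⟨⟨S, hS, rfl⟩, hker, hover⟩ η₂ ⟨⟨T, hT, rfl⟩, hker2, hover2⟩ heq
    rw [hsumH] at hover hover2
    obtain ⟨hY, hZ⟩ := hactH S hS hker (right_ne_zero_of_mul hover)
    obtain ⟨hY2, hZ2⟩ := hactH T hT hker2 (right_ne_zero_of_mul hover2)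
    have e1 := D.rep_inner S.ρ S.ρ hY hY hZ
    have e2 := D.rep_inner S.ρ T.ρ hY hY2 hZ2
    have e3 : ∀ g : V, ((Nat.card H' : ℂ)⁻¹ * ∑ v : V, if hv : v * g * v⁻¹ ∈ H' then
        LinearMap.trace ℂ S (S.ρ ⟨v * g * v⁻¹, hv⟩) else 0) =
        ((Nat.card H' : ℂ)⁻¹ * ∑ v : V, if hv : v * g * v⁻¹ ∈ H' then
        LinearMap.trace ℂ T (T.ρ ⟨v * g * v⁻¹, hv⟩) else 0) := fun g => congrFun heq g
    simp only [← e3] at e2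
    have e4 := mul_left_cancel₀ (mul_ne_zero hcV (inv_ne_zero hcH)) (e1.symm.trans e2)
    have e5 := (FDRep.simple_iff_char_is_norm_one S).1 hS
    have : Invertible (Nat.card H' : ℂ) := invertibleOfNonzero hcH
    have e6 := FDRep.char_orthonormal S T
    unfold FDRep.character at e5 e6
    rw [← e4, e5, inv_mul_cancel₀ hcH] at e6
    split_ifs at e6 with hiso
    · exact FDRep.char_iso hiso.some
    · exact absurd e6 one_ne_zero
  · rintro χ ⟨⟨R, hR, rfl⟩, hover⟩
    rw [hsumV] at hover
    have hZ : ∀ z ∈ Z, R.ρ z = L z • 1 := by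
      intro z hz
      rw [hL z hz]
      exact central_acts R hR Z.subtype (fun z g => hZc z z.2 g) lam
        (right_ne_zero_of_mul hover) ⟨z, hz⟩
    obtain ⟨U, σ, hσY, hσZ, hσ⟩ := D.exists_fixed R.ρ hZ
    have hsimp : CategoryTheory.Simple (FDRep.of σ) := by
      rw [FDRep.simple_iff_char_is_norm_one]
      have e1 := D.rep_inner σ σ hσY hσY hσZ
      simp only [← hσ] at e1
      have e2 := (FDRep.simple_iff_char_is_norm_one R).1 hR
      unfold FDRep.character at e2
      rw [e2, mul_assoc, eq_comm, mul_eq_left₀ hcV] at e1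
      have e3 := (inv_mul_eq_one₀ hcH).1 e1
      exact e3.symm
    refine ⟨(FDRep.of σ).character, ⟨⟨_, hsimp, rfl⟩, ?_, ?_⟩, ?_⟩
    · intro y hy hm
      have : (FDRep.of σ).ρ ⟨y, hm⟩ = (FDRep.of σ).ρ 1 := by
        rw [map_one]; exact hσY y hy
      rw [FDRep.character, this]; rfl
    · rw [hsumH]
      have h1 : ∀ z : Z, (FDRep.of σ).character (Subgroup.inclusion D.Z_le z) *
          (starRingEnd ℂ) ((lam z : ℂˣ) : ℂ) = Module.finrank ℂ (FDRep.of σ) := by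
        intro z
        have h2 : (FDRep.of σ).ρ (Subgroup.inclusion D.Z_le z) = L z • 1 := hσZ z z.2
        rw [FDRep.character, h2, map_smul, LinearMap.trace_one, smul_eq_mul, hL z z.2,
          mul_right_comm, hone, one_mul]
      rw [Finset.sum_congr rfl fun z _ => h1 z, Finset.sum_const, Finset.card_univ,
        ← Nat.card_eq_fintype_card, nsmul_eq_mul, ← mul_assoc, inv_mul_cancel₀ hcZ, one_mul]
      exact char_one_ne _ hsimp
    · funext g
      exact (hσ g).symm
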